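/- Let b be prime, m ∈ ℕ, f(x) = x^m ∈ F_b[x], α > 1, and let (γ_u)_{u⊆[s]} be general positive weights, with reduction indices 0 ≤ w_1 ≤ ⋯ ≤ w_s and Y_j(x) = x^{w_j}. If g = (Y_1 g_1, …, Y_s g_s) is constructed by the reduced SCS algorithm for polynomial lattice rules, then for λ ∈ (1/α, 1], the squared worst-case error in the weighted Walsh space satisfies e²_{N,s}(g) ≤ ( Σ_{d=1}^s Σ_{u⊆[s], d∈u} γ_u^λ · 2(μ_b(αλ))^{|u|} / b^{max(0, m−w_d)} )^{1/λ}, where μ_b(β) = b^β(b−1)/(b^β − b). -/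

import Mathlib

open Polynomial

/-- The polynomial `tr_m(h) = h_0 + h_1 x + ⋯ + h_{m-1} x^{m-1}` formed from the
base-`b` digits of the natural number `h`. -/
noncomputable def trPoly (b : ℕ) (m : ℕ) (h : ℕ) : Polynomial (ZMod b) :=
  ∑ i ∈ Finset.range m, Polynomial.C ((h / b ^ i % b : ℕ) : ZMod b) * X ^ i

/-- Squared worst-case error of the polynomial lattice rule modulo `x^m` with
generating vector `g` in the weighted Walsh space with smoothness `α` and weights `γ`. -/
noncomputable def walshErrSq (b m s : ℕ) (α : ℝ) (γ : Finset (Fin s) → ℝ)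
    (g : Fin s → Polynomial (ZMod b)) : ℝ :=
  ∑ u ∈ Finset.univ.powerset.filter (fun u => u ≠ ∅), γ u *
    ∑' h : {h : Fin s → ℕ //
        (∀ j, j ∈ u ↔ h j ≠ 0) ∧ (X ^ m ∣ ∑ j ∈ u, trPoly b m (h j) * g j)},
      ∏ j ∈ u, (b : ℝ) ^ (-(α * (Nat.log b (h.1 j) : ℝ)))

/-- The reduced search space `G_{N,w}` of polynomials for modulus `x^m` and
reduction index `w`. -/
def polyReducedSearch (b m w : ℕ) : Set (Polynomial (ZMod b)) :=
  if w < m then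
    {g | g ≠ 0 ∧ g.degree < ((m - w : ℕ) : WithBot ℕ) ∧ IsCoprime g (X ^ m)}
  else {1}

namespace SCS

open scoped ENNReal

/-- summand -/
noncomputable def rr (b : ℕ) (β : ℝ) (h : ℕ) : ℝ≥0∞ :=
  if h = 0 then 0 else ENNReal.ofReal ((b : ℝ) ^ (-(β * (Nat.log b h : ℝ))))

noncomputable def ff {s : ℕ} (b : ℕ) (β : ℝ) (u : Finset (Fin s)) (j : Fin s) (h : ℕ) : ℝ≥0∞ :=
  if j ∈ u then rr b β h else if h = 0 then 1 else 0

open Classical in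
noncomputable def TT (b m s : ℕ) (β : ℝ) (u : Finset (Fin s))
    (g : Fin s → Polynomial (ZMod b)) : ℝ≥0∞ :=
  ∑' h : Fin s → ℕ, if X ^ m ∣ ∑ j ∈ u, trPoly b m (h j) * g j then ∏ j, ff b β u j (h j) else 0

noncomputable def MM (b : ℕ) (β : ℝ) : ℝ≥0∞ := ∑' h, rr b β h

noncomputable def mu (b : ℕ) (β : ℝ) : ℝ := (b : ℝ) ^ β * ((b : ℝ) - 1) / ((b : ℝ) ^ β - b)

theorem rpow_sum_le {ι : Type*} (t : Finset ι) (f : ι → ℝ≥0∞) {lam : ℝ} (h0 : 0 < lam)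
    (h1 : lam ≤ 1) : (∑ i ∈ t, f i) ^ lam ≤ ∑ i ∈ t, f i ^ lam := by
  classical
  induction t using Finset.induction_on with
  | empty => simp [h0]
  | insert a t ha ih =>
    rw [Finset.sum_insert ha, Finset.sum_insert ha]
    exact (ENNReal.rpow_add_le_add_rpow _ _ h0.le h1).trans (by gcongr)

theorem rpow_tsum_le {ι : Type*} (f : ι → ℝ≥0∞) {lam : ℝ} (h0 : 0 < lam)
    (h1 : lam ≤ 1) : (∑' i, f i) ^ lam ≤ ∑' i, f i ^ lam := by
  have : (∑' i, f i) ≤ (∑' i, f i ^ lam) ^ (1 / lam) := by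
    rw [ENNReal.tsum_eq_iSup_sum]
    refine iSup_le fun t => ?_
    rw [one_div, ENNReal.le_rpow_inv_iff h0]
    exact (rpow_sum_le t f h0 h1).trans (ENNReal.sum_le_tsum t)
  rwa [one_div, ENNReal.le_rpow_inv_iff h0] at this

theorem tsum_insertNth {n : ℕ} (d : Fin (n + 1)) (F : (Fin (n + 1) → ℕ) → ℝ≥0∞) :
    ∑' h, F h = ∑' h' : Fin n → ℕ, ∑' k : ℕ, F (d.insertNth k h') := by
  rw [← (Fin.insertNthEquiv (fun _ => ℕ) d).tsum_eq, ENNReal.tsum_prod', ENNReal.tsum_comm]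
  rfl

theorem tsum_pi {n : ℕ} (F : Fin n → ℕ → ℝ≥0∞) :
    ∑' h : Fin n → ℕ, ∏ j, F j (h j) = ∏ j, ∑' k, F j k := by
  induction n with
  | zero => simp [tsum_fintype]
  | succ n ih =>
    rw [tsum_insertNth 0]
    simp only [Fin.prod_univ_succ, Fin.insertNth_zero', Fin.cons_zero, Fin.cons_succ]
    simp only [ENNReal.tsum_mul_right, ENNReal.tsum_mul_left]
    rw [ih]

theorem tsum_ff {s : ℕ} (b : ℕ) (β : ℝ) (u : Finset (Fin s)) (j : Fin s) :
    ∑' k, ff b β u j k = if j ∈ u then MM b β else 1 := by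
  unfold ff MM
  split_ifs
  · rfl
  · rw [tsum_ite_eq]

theorem TT_le {b m s : ℕ} (β : ℝ) (u : Finset (Fin s))
    (g : Fin s → Polynomial (ZMod b)) : TT b m s β u g ≤ MM b β ^ u.card := by
  classical
  calc TT b m s β u g ≤ ∑' h : Fin s → ℕ, ∏ j, ff b β u j (h j) := by
        refine ENNReal.tsum_le_tsum fun h => ?_
        split_ifs <;> simp
    _ = MM b β ^ u.card := by
        rw [tsum_pi]
        simp only [tsum_ff]
        rw [Finset.prod_ite]
        simp

theorem rr_scale {b : ℕ} (hb : 1 < b) (β : ℝ) (k h : ℕ) :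
    rr b β (b ^ k * h) = ENNReal.ofReal ((b : ℝ) ^ (-(β * k))) * rr b β h := by
  have hb0 : (0:ℝ) < b := by positivity
  unfold rr
  by_cases hh : h = 0
  · simp [hh]
  · have h2 : b ^ k * h ≠ 0 := by positivity
    rw [if_neg hh, if_neg h2, ← ENNReal.ofReal_mul (by positivity), ← Real.rpow_add hb0]
    have : Nat.log b (b ^ k * h) = Nat.log b h + k := by
      clear h2
      induction k with
      | zero => simp
      | succ k ih =>
        rw [pow_succ, mul_right_comm, Nat.log_mul_base hb (by positivity), ih]; ring
    rw [this]; push_cast; ring_nf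

theorem tsum_dvd {b : ℕ} (hb : 1 < b) (β : ℝ) (k : ℕ) :
    ∑' h, (if b ^ k ∣ h then rr b β h else 0) =
      ENNReal.ofReal ((b : ℝ) ^ (-(β * k))) * MM b β := by
  have hinj : Function.Injective (fun h : ℕ => b ^ k * h) := by
    intro x y hxy
    exact Nat.eq_of_mul_eq_mul_left (by positivity) hxy
  rw [← hinj.tsum_eq]
  · simp only [dvd_mul_right, if_true, rr_scale hb, ENNReal.tsum_mul_left]; rfl
  · intro h hh
    simp only [Function.mem_support, ne_eq, ite_eq_right_iff, Classical.not_imp] at hh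
    obtain ⟨⟨c, hc⟩, _⟩ := hh
    exact ⟨c, hc.symm⟩

theorem MM_eq {b : ℕ} (hb : 1 < b) {β : ℝ} (hβ : 1 < β) : MM b β = ENNReal.ofReal (mu b β) := by
  have hb0 : (0:ℝ) < b := by positivity
  have hb1 : (1:ℝ) < b := by exact_mod_cast hb
  have h1 : ∀ h, rr b β h = ∑' k : ℕ, if h ∈ Finset.Ico (b ^ k) (b ^ (k+1)) then
      ENNReal.ofReal ((b : ℝ) ^ (-(β * k))) else 0 := by
    intro h
    unfold rr
    by_cases hh : h = 0
    · subst hh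
      symm
      refine ENNReal.tsum_eq_zero.2 fun k => ?_
      rw [if_neg]
      rw [Finset.mem_Ico]
      have : 0 < b ^ k := by positivity
      omega
    · rw [if_neg hh, tsum_eq_single (Nat.log b h)]
      · rw [if_pos]
        rw [Finset.mem_Ico]
        exact ⟨Nat.pow_log_le_self b hh, Nat.lt_pow_succ_log_self hb h⟩
      · intro k hk
        rw [if_neg]
        rw [Finset.mem_Ico]
        intro hc
        exact hk ((Nat.log_eq_iff (Or.inr ⟨hb, hh⟩)).2 hc).symm
  have h2 : MM b β = ∑' k : ℕ, ENNReal.ofReal (((b:ℝ) - 1) * ((b : ℝ) ^ (1 - β)) ^ k) := by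
    unfold MM
    simp_rw [h1]
    rw [ENNReal.tsum_comm]
    refine tsum_congr fun k => ?_
    rw [tsum_eq_sum (s := Finset.Ico (b ^ k) (b ^ (k+1))) (by intro x hx; rw [if_neg hx])]
    rw [Finset.sum_congr rfl (fun x hx => if_pos hx), Finset.sum_const, Nat.card_Ico, nsmul_eq_mul]
    rw [← ENNReal.ofReal_natCast, ← ENNReal.ofReal_mul (by positivity)]
    congr 1
    rw [Nat.cast_sub (Nat.pow_le_pow_right (by omega) (by omega)), ← Real.rpow_natCast, ← Real.rpow_mul hb0.le]
    have : (1 - β) * (k:ℝ) = k + -(β * k) := by ring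
    rw [this, Real.rpow_add hb0, Real.rpow_natCast]
    push_cast; ring
  have hr0 : 0 ≤ (b:ℝ) ^ (1 - β) := by positivity
  have hr1 : (b:ℝ) ^ (1 - β) < 1 := Real.rpow_lt_one_of_one_lt_of_neg hb1 (by linarith)
  rw [h2, ← ENNReal.ofReal_tsum_of_nonneg]
  · congr 1
    rw [tsum_mul_left, tsum_geometric_of_lt_one hr0 hr1]
    unfold mu
    have hB : (b:ℝ) < (b:ℝ) ^ β := by
      simpa using Real.rpow_lt_rpow_of_exponent_lt hb1 hβ
    rw [Real.rpow_sub hb0, Real.rpow_one] at *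
    have h3 : (b:ℝ) ^ β - b ≠ 0 := by linarith
    have h4 : (b:ℝ) ^ β ≠ 0 := by linarith
    have h5 : 1 - (b:ℝ) / (b:ℝ) ^ β ≠ 0 := by linarith
    field_simp
  · intro k
    have : 0 ≤ (b:ℝ) - 1 := by linarith
    positivity
  · exact (summable_geometric_of_lt_one hr0 hr1).mul_left _

theorem mu_pos {b : ℕ} (hb : 1 < b) {β : ℝ} (hβ : 1 < β) : 0 < mu b β := by
  have hb1 : (1:ℝ) < b := by exact_mod_cast hb
  have hB : (b:ℝ) < (b:ℝ) ^ β := by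
    simpa using Real.rpow_lt_rpow_of_exponent_lt hb1 hβ
  unfold mu
  have : 0 < (b:ℝ) - 1 := by linarith
  have : 0 < (b:ℝ)^β - b := by linarith
  positivity

theorem rr_rpow {b : ℕ} (hb : 1 < b) (α : ℝ) {lam : ℝ} (h0 : 0 < lam) (h : ℕ) :
    (rr b α h) ^ lam = rr b (α * lam) h := by
  have hb0 : (0:ℝ) < b := by positivity
  unfold rr
  split_ifs
  · simp [h0]
  · rw [ENNReal.ofReal_rpow_of_pos (by positivity), ← Real.rpow_mul hb0.le]
    ring_nf

theorem TT_rpow_le {b m s : ℕ} (hb : 1 < b) (α : ℝ) {lam : ℝ} (h0 : 0 < lam) (h1 : lam ≤ 1)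
    (u : Finset (Fin s)) (g : Fin s → Polynomial (ZMod b)) :
    (TT b m s α u g) ^ lam ≤ TT b m s (α * lam) u g := by
  classical
  unfold TT
  refine (rpow_tsum_le _ h0 h1).trans (le_of_eq (tsum_congr fun h => ?_))
  split_ifs
  · rw [← ENNReal.prod_rpow_of_nonneg h0.le]
    refine Finset.prod_congr rfl fun j _ => ?_
    unfold ff
    split_ifs
    · exact rr_rpow hb α h0 _
    · simp
    · simp [h0]
  · simp [h0]

theorem walsh_eq {b m s : ℕ} (hb : 1 < b) {α : ℝ} (hα : 1 < α) (γ : Finset (Fin s) → ℝ)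
    (hγ : ∀ u, 0 < γ u) (g : Fin s → Polynomial (ZMod b)) :
    walshErrSq b m s α γ g = (∑ u ∈ Finset.univ.powerset.filter (fun u => u ≠ ∅),
      ENNReal.ofReal (γ u) * TT b m s α u g).toReal := by
  classical
  have hfin : ∀ u, TT b m s α u g ≠ ⊤ := fun u => by
    refine ne_top_of_le_ne_top ?_ (TT_le α u g)
    rw [MM_eq hb hα]; simp
  unfold walshErrSq
  rw [ENNReal.toReal_sum (fun u _ => ENNReal.mul_ne_top ENNReal.ofReal_ne_top (hfin u))]
  refine Finset.sum_congr rfl fun u _ => ?_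
  rw [ENNReal.toReal_mul, ENNReal.toReal_ofReal (hγ u).le]
  congr 1
  have hb0 : (0:ℝ) < b := by positivity
  have : ∀ h : {h : Fin s → ℕ //
        (∀ j, j ∈ u ↔ h j ≠ 0) ∧ (X ^ m ∣ ∑ j ∈ u, trPoly b m (h j) * g j)},
      ∏ j ∈ u, (b : ℝ) ^ (-(α * (Nat.log b (h.1 j) : ℝ))) =
      (∏ j ∈ u, ENNReal.ofReal ((b : ℝ) ^ (-(α * (Nat.log b (h.1 j) : ℝ))))).toReal := by
    intro h
    rw [ENNReal.toReal_prod]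
    refine Finset.prod_congr rfl fun j _ => ?_
    rw [ENNReal.toReal_ofReal (by positivity)]
  rw [tsum_congr this, ← ENNReal.tsum_toReal_eq]
  · congr 1
    refine (tsum_subtype {h : Fin s → ℕ |
        (∀ j, j ∈ u ↔ h j ≠ 0) ∧ (X ^ m ∣ ∑ j ∈ u, trPoly b m (h j) * g j)}
      (fun h => ∏ j ∈ u, ENNReal.ofReal ((b : ℝ) ^ (-(α * (Nat.log b (h j) : ℝ)))))).trans ?_
    unfold TT
    refine tsum_congr fun h => ?_
    rw [Set.indicator_apply]
    simp only [Set.mem_ofPred_eq]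
    by_cases hd : X ^ m ∣ ∑ j ∈ u, trPoly b m (h j) * g j
    · simp only [hd, and_true, if_true]
      split_ifs with hu
      · rw [← Finset.prod_subset (Finset.subset_univ u)]
        · refine Finset.prod_congr rfl fun j hj => ?_
          simp [ff, rr, hj, (hu j).1 hj]
        · intro j _ hj
          have := (hu j).not.1 hj
          simp at this
          simp [ff, hj, this]
      · push Not at hu
        obtain ⟨j, hj⟩ := hu
        symm
        refine Finset.prod_eq_zero (Finset.mem_univ j) ?_
        rcases hj with ⟨h1, h2⟩ | ⟨h1, h2⟩
        · simp [ff, rr, h1, h2]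
        · simp [ff, h1, h2]
    · simp [hd]
  · intro h
    exact ENNReal.prod_ne_top fun _ _ => ENNReal.ofReal_ne_top

theorem trPoly_coeff {b m h i : ℕ} (hi : i < m) :
    (trPoly b m h).coeff i = ((h / b ^ i % b : ℕ) : ZMod b) := by
  unfold trPoly
  rw [finsetSum_coeff, Finset.sum_eq_single i]
  · simp
  · intro j _ hj
    simp [coeff_X_pow, hj.symm]
  · intro h; exact absurd (Finset.mem_range.2 hi) h

theorem X_pow_dvd_trPoly {b m h k : ℕ} (hb : 1 < b) (hk : k ≤ m) :
    X ^ k ∣ trPoly b m h ↔ b ^ k ∣ h := by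
  rw [X_pow_dvd_iff]
  induction k with
  | zero => simp
  | succ k ih =>
    have hc : (trPoly b m h).coeff k = 0 ↔ b ∣ h / b ^ k := by
      rw [trPoly_coeff (by omega), ZMod.natCast_eq_zero_iff, Nat.dvd_mod_iff (dvd_refl b)]
    have : (∀ d < k + 1, (trPoly b m h).coeff d = 0) ↔
        (∀ d < k, (trPoly b m h).coeff d = 0) ∧ (trPoly b m h).coeff k = 0 := by
      constructor
      · intro H; exact ⟨fun d hd => H d (by omega), H k (by omega)⟩
      · rintro ⟨H1, H2⟩ d hd
        rcases Nat.lt_succ_iff_lt_or_eq.1 hd with h | h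
        · exact H1 d h
        · rw [h]; exact H2
    rw [this, ih (by omega), hc]
    constructor
    · rintro ⟨⟨q, rfl⟩, h2⟩
      rw [Nat.mul_div_cancel_left _ (by positivity)] at h2
      rw [pow_succ]; exact Nat.mul_dvd_mul_left _ h2
    · rintro ⟨q, rfl⟩
      rw [pow_succ, mul_assoc]
      refine ⟨dvd_mul_right _ _, ?_⟩
      rw [Nat.mul_div_cancel_left _ (by positivity)]
      exact dvd_mul_right _ _

noncomputable def yy {b n : ℕ} (c : Fin n → ZMod b) : Polynomial (ZMod b) :=
  ∑ i : Fin n, C (c i) * X ^ (i : ℕ)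

theorem yy_coeff {b n : ℕ} (c : Fin n → ZMod b) (i : Fin n) : (yy c).coeff i = c i := by
  unfold yy
  rw [finsetSum_coeff, Finset.sum_eq_single i]
  · simp
  · intro j _ hj
    simp [coeff_X_pow, Fin.val_inj, hj.symm]
  · intro h; exact absurd (Finset.mem_univ i) h

theorem yy_degree {b n : ℕ} (c : Fin n → ZMod b) : (yy c).degree < (n : WithBot ℕ) := by
  rw [degree_lt_iff_coeff_zero]
  intro k hk
  unfold yy
  rw [finsetSum_coeff]
  refine Finset.sum_eq_zero fun j _ => ?_
  have : k ≠ j := by have := j.2; omega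
  simp [coeff_X_pow, this]

theorem X_not_dvd_yy {b n : ℕ} (c : Fin (n + 1) → ZMod b) (hc : c 0 ≠ 0) : ¬ X ∣ yy c := by
  rw [X_dvd_iff]
  have := yy_coeff c 0
  simp only [Fin.val_zero] at this
  rwa [this]

theorem yy_mem {b m w n : ℕ} [Fact b.Prime] (hn : m = w + (n + 1)) (c : Fin (n + 1) → ZMod b)
    (hc : c 0 ≠ 0) : yy c ∈ polyReducedSearch b m w := by
  have h1 := X_not_dvd_yy c hc
  unfold polyReducedSearch
  rw [if_pos (by omega)]
  refine ⟨?_, ?_, ?_⟩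
  · intro h; rw [h] at h1; exact h1 (dvd_zero _)
  · have : m - w = n + 1 := by omega
    rw [this]; exact yy_degree c
  · exact (((irreducible_X.coprime_iff_not_dvd).2 h1).symm).pow_right

theorem X_pow_dvd_mul {b : ℕ} [Fact b.Prime] {p y : Polynomial (ZMod b)} (hy : ¬ X ∣ y) (j : ℕ) :
    X ^ j ∣ p * y ↔ X ^ j ∣ p := by
  have h : IsCoprime (X ^ j) y := ((irreducible_X.coprime_iff_not_dvd).2 hy).pow_left
  exact ⟨fun H => h.dvd_of_dvd_mul_right H, fun H => H.mul_right y⟩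

theorem sol_iff {b m w n : ℕ} [Fact b.Prime] (hn : m = w + (n + 1)) (c : Fin (n + 1) → ZMod b)
    (hc : c 0 ≠ 0) {h : ℕ} {e : Polynomial (ZMod b)}
    (hs : X ^ m ∣ trPoly b m h * (X ^ w * yy c) + e) {j : ℕ} (hj : j ≤ n + 1) :
    b ^ j ∣ h ↔ X ^ (w + j) ∣ e := by
  have hb : 1 < b := (Fact.out : b.Prime).one_lt
  have h1 : X ^ (w + j) ∣ trPoly b m h * (X ^ w * yy c) + e :=
    (pow_dvd_pow X (by omega)).trans hs
  rw [show (X ^ (w + j) ∣ e) ↔ X ^ (w + j) ∣ trPoly b m h * (X ^ w * yy c) from ⟨fun H => (dvd_add_left H).1 h1, fun H => (dvd_add_right H).1 h1⟩]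
  have h2 : trPoly b m h * (X ^ w * yy c) = X ^ w * (trPoly b m h * yy c) := by ring
  rw [h2, pow_add, mul_dvd_mul_iff_left (pow_ne_zero _ X_ne_zero),
    X_pow_dvd_mul (X_not_dvd_yy c hc), X_pow_dvd_trPoly hb (by omega)]

open Classical in
noncomputable def cnt (b m w n : ℕ) [Fact b.Prime] (e : Polynomial (ZMod b)) (h : ℕ) :
    Finset (Fin (n + 1) → ZMod b) :=
  (Finset.univ.filter (fun c : Fin (n + 1) → ZMod b => c 0 ≠ 0)).filter
    (fun c => X ^ m ∣ trPoly b m h * (X ^ w * yy c) + e)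

theorem cnt_le {b m w n : ℕ} [Fact b.Prime] (hn : m = w + (n + 1)) (e : Polynomial (ZMod b))
    {h k : ℕ} (hk : k < n + 1) (h1 : b ^ k ∣ h) (h2 : ¬ b ^ (k + 1) ∣ h) :
    (cnt b m w n e h).card ≤ b ^ k := by
  classical
  have hb : 1 < b := (Fact.out : b.Prime).one_lt
  have hcard : (Finset.univ : Finset (Fin k → ZMod b)).card = b ^ k := by
    simp [ZMod.card]
  rw [← hcard]
  refine Finset.card_le_card_of_injOn
    (fun c (i : Fin k) => c ⟨n + 1 - k + i, by have := i.2; omega⟩) (fun _ _ => by simp) ?_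
  intro c hc c' hc' heq
  simp only [cnt, Finset.coe_filter, Finset.mem_filter, Finset.mem_univ, true_and,
    Set.mem_ofPred_eq] at hc hc'
  obtain ⟨q, hq⟩ := (X_pow_dvd_trPoly hb (by omega : k ≤ m)).2 h1
  have hXq : ¬ X ∣ q := by
    rintro ⟨r, rfl⟩
    apply h2
    rw [← X_pow_dvd_trPoly hb (by omega : k + 1 ≤ m), hq]
    exact ⟨r, by ring⟩
  have h3 := dvd_sub hc.2 hc'.2
  have h4 : trPoly b m h * (X ^ w * yy c) + e - (trPoly b m h * (X ^ w * yy c') + e) =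
      X ^ (w + k) * ((yy c - yy c') * q) := by rw [hq]; ring
  have h5 : m = (w + k) + (n + 1 - k) := by omega
  rw [h4] at h3
  rw [show (X : Polynomial (ZMod b)) ^ m = X ^ (w + k) * X ^ (n + 1 - k) by rw [← pow_add, ← h5],
    mul_dvd_mul_iff_left (pow_ne_zero _ X_ne_zero), X_pow_dvd_mul hXq, X_pow_dvd_iff] at h3
  funext i
  by_cases hi : (i : ℕ) < n + 1 - k
  · have := h3 i hi
    rw [coeff_sub, yy_coeff, yy_coeff, sub_eq_zero] at this
    exact this
  · have := congrFun heq ⟨i - (n + 1 - k), by have := i.2; omega⟩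
    simp only at this
    have hi' : (⟨n + 1 - k + (i - (n + 1 - k)), by have := i.2; omega⟩ : Fin (n + 1)) = i :=
      Fin.ext (by simp; omega)
    rw [hi'] at this
    exact this

noncomputable def II (b n : ℕ) [Fact b.Prime] : Finset (Fin (n + 1) → ZMod b) :=
  Finset.univ.filter (fun c => c 0 ≠ 0)

theorem II_card (b n : ℕ) [Fact b.Prime] : b ^ (n + 1) ≤ 2 * (II b n).card := by
  classical
  have h1 : (Finset.univ : Finset (Fin (n + 1) → ZMod b)).card = b ^ (n + 1) := by
    simp [ZMod.card]
  have h2 := Finset.card_filter_add_card_filter_not (s := (Finset.univ : Finset (Fin (n + 1) → ZMod b)))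
    (fun c => c 0 ≠ 0)
  have h3 : (Finset.univ.filter (fun c : Fin (n + 1) → ZMod b => ¬ c 0 ≠ 0)).card ≤
      (II b n).card := by
    refine Finset.card_le_card_of_injOn (fun c => Function.update c 0 1) ?_ ?_
    · intro c _
      simp [II]
    · intro c hc c' hc' heq
      simp only [Finset.coe_filter, Finset.mem_univ, true_and, Set.mem_ofPred_eq, not_not] at hc hc'
      funext i
      by_cases hi : i = 0
      · rw [hi, hc, hc']
      · have := congrFun heq i
        simpa [hi] using this
  unfold II at *
  omega

theorem pow_mul_le {b : ℕ} (hb : 1 < b) {β : ℝ} (hβ : 1 < β) (k : ℕ) :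
    (b : ℝ≥0∞) ^ k * ENNReal.ofReal ((b : ℝ) ^ (-(β * k))) ≤ 1 := by
  have hb0 : (0:ℝ) < b := by positivity
  have hb1 : (1:ℝ) ≤ b := by exact_mod_cast hb.le
  rw [← ENNReal.ofReal_natCast, ← ENNReal.ofReal_pow hb0.le, ← ENNReal.ofReal_mul (by positivity),
    ← ENNReal.ofReal_one]
  apply ENNReal.ofReal_le_ofReal
  rw [← Real.rpow_natCast, ← Real.rpow_add hb0]
  apply Real.rpow_le_one_of_one_le_of_nonpos hb1
  have : (0:ℝ) ≤ k := by positivity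
  nlinarith

theorem inner_bound {b m w n : ℕ} [Fact b.Prime] (hn : m = w + (n + 1)) {β : ℝ} (hβ : 1 < β)
    (e : Polynomial (ZMod b)) :
    (b : ℝ≥0∞) ^ (n + 1) * ∑' h, rr b β h * ((cnt b m w n e h).card : ℝ≥0∞) ≤
      (II b n).card * (2 * MM b β) := by
  classical
  have hb : 1 < b := (Fact.out : b.Prime).one_lt
  by_cases H : ∀ h, (cnt b m w n e h).Nonempty → b ^ (n + 1) ∣ h
  · have h1 : ∑' h, rr b β h * ((cnt b m w n e h).card : ℝ≥0∞) ≤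
        ∑' h, (if b ^ (n + 1) ∣ h then rr b β h else 0) * ((II b n).card : ℝ≥0∞) := by
      refine ENNReal.tsum_le_tsum fun h => ?_
      rcases (cnt b m w n e h).eq_empty_or_nonempty with h0 | h0
      · simp [h0]
      · rw [if_pos (H h h0)]
        gcongr
        unfold cnt II
        convert Finset.filter_subset _ _
    rw [ENNReal.tsum_mul_right, tsum_dvd hb] at h1
    calc _ ≤ (b : ℝ≥0∞) ^ (n + 1) * (ENNReal.ofReal ((b : ℝ) ^ (-(β * (n + 1 : ℕ)))) * MM b β *
            ((II b n).card : ℝ≥0∞)) := by gcongr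
      _ = ((b : ℝ≥0∞) ^ (n + 1) * ENNReal.ofReal ((b : ℝ) ^ (-(β * (n + 1 : ℕ))))) *
            (((II b n).card : ℝ≥0∞) * MM b β) := by ring
      _ ≤ 1 * (((II b n).card : ℝ≥0∞) * (2 * MM b β)) := by
          gcongr
          · exact pow_mul_le hb hβ _
          · exact le_mul_of_one_le_left' (by norm_num)
      _ = _ := one_mul _
  · push Not at H
    obtain ⟨h0, ⟨c0, hc0⟩, hnd⟩ := H
    have hex : ∃ j, ¬ b ^ (j + 1) ∣ h0 := ⟨n, hnd⟩
    obtain ⟨k, hk1, hk2⟩ : ∃ k, ¬ b ^ (k + 1) ∣ h0 ∧ ∀ j < k, b ^ (j + 1) ∣ h0 :=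
      ⟨Nat.find hex, Nat.find_spec hex, fun j hj => not_not.1 (Nat.find_min hex hj)⟩
    have hkn : k < n + 1 := by
      by_contra hlt
      exact hnd (hk2 n (by omega))
    have hk3 : b ^ k ∣ h0 := by
      rcases k with _ | k
      · simp
      · exact hk2 k (by omega)
    simp only [cnt, Finset.mem_filter, Finset.mem_univ, true_and] at hc0
    have h1 : ∑' h, rr b β h * ((cnt b m w n e h).card : ℝ≥0∞) ≤
        ∑' h, (if b ^ k ∣ h then rr b β h else 0) * (b : ℝ≥0∞) ^ k := by
      refine ENNReal.tsum_le_tsum fun h => ?_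
      rcases (cnt b m w n e h).eq_empty_or_nonempty with he | ⟨c, hc⟩
      · simp [he]
      · simp only [cnt, Finset.mem_filter, Finset.mem_univ, true_and] at hc
        have ha : b ^ k ∣ h := by
          rw [sol_iff hn c hc.1 hc.2 (by omega), ← sol_iff hn c0 hc0.1 hc0.2 (by omega)]
          exact hk3
        have hb' : ¬ b ^ (k + 1) ∣ h := by
          rw [sol_iff hn c hc.1 hc.2 (by omega), ← sol_iff hn c0 hc0.1 hc0.2 (by omega)]
          exact hk1
        rw [if_pos ha]
        gcongr
        exact_mod_cast cnt_le hn e hkn ha hb'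
    rw [ENNReal.tsum_mul_right, tsum_dvd hb] at h1
    have h2 : ∑' h, rr b β h * ((cnt b m w n e h).card : ℝ≥0∞) ≤ MM b β := by
      refine h1.trans ?_
      calc _ = ((b : ℝ≥0∞) ^ k * ENNReal.ofReal ((b : ℝ) ^ (-(β * k)))) * MM b β := by ring
        _ ≤ 1 * MM b β := by gcongr; exact pow_mul_le hb hβ _
        _ = _ := one_mul _
    have h3 : (b : ℝ≥0∞) ^ (n + 1) ≤ 2 * ((II b n).card : ℝ≥0∞) := by
      exact_mod_cast II_card b n
    calc _ ≤ (2 * ((II b n).card : ℝ≥0∞)) * MM b β := by gcongr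
      _ = _ := by ring

theorem avg_bound {b m w n t : ℕ} [Fact b.Prime] (hn : m = w + (n + 1)) {β : ℝ} (hβ : 1 < β)
    (d : Fin (t + 1)) (u : Finset (Fin (t + 1))) (hd : d ∈ u)
    (V : (Fin (n + 1) → ZMod b) → Fin (t + 1) → Polynomial (ZMod b))
    (G : Fin (t + 1) → Polynomial (ZMod b))
    (hV1 : ∀ c, V c d = X ^ w * yy c) (hV2 : ∀ c j, j ≠ d → V c j = G j) :
    (b : ℝ≥0∞) ^ (n + 1) * ∑ c ∈ II b n, TT b m (t + 1) β u (V c) ≤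
      (II b n).card * (2 * MM b β ^ u.card) := by
  classical
  set e : (Fin t → ℕ) → Polynomial (ZMod b) := fun h' =>
    ∑ j ∈ u.erase d, trPoly b m ((d.insertNth 0 h' : Fin (t + 1) → ℕ) j) * G j with he
  set P : (Fin t → ℕ) → ℝ≥0∞ := fun h' => ∏ i, ff b β u (d.succAbove i) (h' i) with hP
  have hsum : ∀ c k h', ∑ j ∈ u, trPoly b m ((d.insertNth k h' : Fin (t + 1) → ℕ) j) * V c j =
      trPoly b m k * (X ^ w * yy c) + e h' := by
    intro c k h'
    rw [← Finset.add_sum_erase u _ hd, hV1, Fin.insertNth_apply_same, he]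
    congr 1
    refine Finset.sum_congr rfl fun j hj => ?_
    have hjd := Finset.ne_of_mem_erase hj
    rw [hV2 c j hjd]
    obtain ⟨i, rfl⟩ := Fin.exists_succAbove_eq hjd
    rw [Fin.insertNth_apply_succAbove, Fin.insertNth_apply_succAbove]
  have hprod : ∀ k h', ∏ j, ff b β u j ((d.insertNth k h' : Fin (t + 1) → ℕ) j) =
      rr b β k * P h' := by
    intro k h'
    rw [Fin.prod_univ_succAbove _ d]
    simp [ff, hd, hP]
  have hT : ∑ c ∈ II b n, TT b m (t + 1) β u (V c) =
      ∑' h', P h' * ∑' k, rr b β k * ((cnt b m w n (e h') k).card : ℝ≥0∞) := by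
    unfold TT
    rw [← Summable.tsum_finsetSum (fun _ _ => ENNReal.summable), tsum_insertNth d]
    refine tsum_congr fun h' => ?_
    rw [← ENNReal.tsum_mul_left]
    refine tsum_congr fun k => ?_
    simp only [hsum, hprod]
    rw [← Finset.sum_filter, Finset.sum_const, nsmul_eq_mul]
    have : (Finset.filter (fun c => X ^ m ∣ trPoly b m k * (X ^ w * yy c) + e h') (II b n)) =
        cnt b m w n (e h') k := by
      unfold cnt II
      congr
    rw [this]; ring
  have hPs : (∑' h', P h') * MM b β = MM b β ^ u.card := by
    rw [hP, tsum_pi (fun i => ff b β u (d.succAbove i))]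
    have h1 : ∏ j, ∑' k, ff b β u j k = MM b β ^ u.card := by
      simp only [tsum_ff]
      rw [Finset.prod_ite]
      simp
    rw [Fin.prod_univ_succAbove _ d, tsum_ff, if_pos hd] at h1
    rw [← h1, mul_comm]
  rw [hT, ← ENNReal.tsum_mul_left]
  calc _ = ∑' h', P h' * ((b : ℝ≥0∞) ^ (n + 1) *
          ∑' k, rr b β k * ((cnt b m w n (e h') k).card : ℝ≥0∞)) :=
        tsum_congr fun h' => by ring
    _ ≤ ∑' h', P h' * ((II b n).card * (2 * MM b β)) :=
        ENNReal.tsum_le_tsum fun h' => mul_le_mul_right (inner_bound hn hβ _) _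
    _ = _ := by rw [ENNReal.tsum_mul_right, ← hPs]; ring

/-- error -/
noncomputable def EE (b m s : ℕ) (α : ℝ) (γ : Finset (Fin s) → ℝ)
    (g : Fin s → Polynomial (ZMod b)) : ℝ≥0∞ :=
  ∑ u ∈ Finset.univ.powerset.filter (fun u => u ≠ ∅), ENNReal.ofReal (γ u) * TT b m s α u g

noncomputable def TH (b m s : ℕ) (α : ℝ) (γ : Finset (Fin s) → ℝ) (d : Fin s)
    (g : Fin s → Polynomial (ZMod b)) : ℝ≥0∞ :=
  ∑ u ∈ Finset.univ.powerset.filter (fun u => d ∈ u), ENNReal.ofReal (γ u) * TT b m s α u g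

theorem TT_ne_top {b m s : ℕ} (hb : 1 < b) {α : ℝ} (hα : 1 < α) (u : Finset (Fin s))
    (g : Fin s → Polynomial (ZMod b)) : TT b m s α u g ≠ ⊤ := by
  refine ne_top_of_le_ne_top ?_ (TT_le α u g)
  rw [MM_eq hb hα]; simp

theorem TT_congr {b m s : ℕ} (α : ℝ) (u : Finset (Fin s))
    (g g' : Fin s → Polynomial (ZMod b)) (h : ∀ j ∈ u, g j = g' j) :
    TT b m s α u g = TT b m s α u g' := by
  unfold TT
  refine tsum_congr fun k => ?_
  rw [Finset.sum_congr rfl (fun j hj => by rw [h j hj])]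

theorem EE_ne_top {b m s : ℕ} (hb : 1 < b) {α : ℝ} (hα : 1 < α) (γ : Finset (Fin s) → ℝ)
    (g : Fin s → Polynomial (ZMod b)) : EE b m s α γ g ≠ ⊤ :=
  ENNReal.sum_ne_top.2 fun u _ => ENNReal.mul_ne_top ENNReal.ofReal_ne_top (TT_ne_top hb hα u g)

/-- changing only component `d` and the error ordering -/
theorem TH_le_of_EE_le {b m s : ℕ} (hb : 1 < b) {α : ℝ} (hα : 1 < α) (γ : Finset (Fin s) → ℝ)
    (d : Fin s) (g g' : Fin s → Polynomial (ZMod b)) (h : ∀ j, j ≠ d → g j = g' j)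
    (hE : EE b m s α γ g ≤ EE b m s α γ g') : TH b m s α γ d g ≤ TH b m s α γ d g' := by
  classical
  have key : ∀ g, EE b m s α γ g = TH b m s α γ d g +
      ∑ u ∈ (Finset.univ.powerset.filter (fun u => u ≠ ∅)).filter (fun u => d ∉ u),
        ENNReal.ofReal (γ u) * TT b m s α u g := by
    intro g
    unfold EE TH
    rw [← Finset.sum_filter_add_sum_filter_not _ (fun u => d ∈ u)]
    congr 1
    refine Finset.sum_congr ?_ fun _ _ => rfl
    ext u
    simp only [Finset.mem_filter, Finset.mem_powerset, Finset.subset_univ, true_and]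
    constructor
    · exact fun h => h.2
    · intro h; exact ⟨Finset.ne_empty_of_mem h, h⟩
  rw [key g, key g'] at hE
  have : ∑ u ∈ (Finset.univ.powerset.filter (fun u => u ≠ ∅)).filter (fun u => d ∉ u),
        ENNReal.ofReal (γ u) * TT b m s α u g =
      ∑ u ∈ (Finset.univ.powerset.filter (fun u => u ≠ ∅)).filter (fun u => d ∉ u),
        ENNReal.ofReal (γ u) * TT b m s α u g' := by
    refine Finset.sum_congr rfl fun u hu => ?_
    rw [TT_congr α u g g']
    intro j hj
    apply h
    rintro rfl
    exact (Finset.mem_filter.1 hu).2 hj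
  rw [this] at hE
  refine (ENNReal.add_le_add_iff_right ?_).1 hE
  exact ENNReal.sum_ne_top.2 fun u _ =>
    ENNReal.mul_ne_top ENNReal.ofReal_ne_top (TT_ne_top hb hα u g')

theorem TH_rpow_le {b m s : ℕ} (hb : 1 < b) (α : ℝ) {lam : ℝ} (h0 : 0 < lam) (h1 : lam ≤ 1)
    (γ : Finset (Fin s) → ℝ) (d : Fin s) (g : Fin s → Polynomial (ZMod b)) :
    (TH b m s α γ d g) ^ lam ≤ ∑ u ∈ Finset.univ.powerset.filter (fun u => d ∈ u),
      ENNReal.ofReal (γ u) ^ lam * TT b m s (α * lam) u g := by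
  unfold TH
  refine (rpow_sum_le _ _ h0 h1).trans (Finset.sum_le_sum fun u _ => ?_)
  rw [ENNReal.mul_rpow_of_nonneg _ _ h0.le]
  gcongr
  exact TT_rpow_le hb α h0 h1 u g

theorem step_bound {b m t : ℕ} [Fact b.Prime] {α : ℝ} (hα : 1 < α)
    {lam : ℝ} (h0 : 0 < lam) (h1 : lam ≤ 1) (hβ : 1 < α * lam)
    (γ : Finset (Fin (t + 1)) → ℝ) (d : Fin (t + 1)) (w : ℕ)
    (V : Polynomial (ZMod b) → Fin (t + 1) → Polynomial (ZMod b))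
    (G : Fin (t + 1) → Polynomial (ZMod b))
    (hV1 : ∀ y, V y d = X ^ w * y) (hV2 : ∀ y j, j ≠ d → V y j = G j) (y0 : Polynomial (ZMod b))
    (hmin : ∀ y ∈ polyReducedSearch b m w, EE b m (t + 1) α γ (V y0) ≤ EE b m (t + 1) α γ (V y)) :
    (TH b m (t + 1) α γ d (V y0)) ^ lam ≤
      ∑ u ∈ Finset.univ.powerset.filter (fun u => d ∈ u),
        ENNReal.ofReal (γ u) ^ lam * (2 * MM b (α * lam) ^ u.card) / (b : ℝ≥0∞) ^ (m - w) := by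
  have hb : 1 < b := (Fact.out : b.Prime).one_lt
  by_cases hw : w < m
  · obtain ⟨n, hn⟩ : ∃ n, m = w + (n + 1) := ⟨m - w - 1, by omega⟩
    have hmw : m - w = n + 1 := by omega
    rw [hmw]
    have hcard : ((II b n).card : ℝ≥0∞) ≠ 0 := by
      have := II_card b n
      have h2 : 0 < b ^ (n + 1) := by positivity
      have : (II b n).card ≠ 0 := by omega
      exact_mod_cast this
    have hbp : (b : ℝ≥0∞) ^ (n + 1) ≠ 0 := by
      have : b ≠ 0 := by omega
      exact pow_ne_zero _ (by exact_mod_cast this)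
    have hbt : (b : ℝ≥0∞) ^ (n + 1) ≠ ⊤ := ENNReal.pow_ne_top (ENNReal.natCast_ne_top b)
    have hmean : ((II b n).card : ℝ≥0∞) * (TH b m (t + 1) α γ d (V y0)) ^ lam ≤
        ∑ c ∈ II b n, ∑ u ∈ Finset.univ.powerset.filter (fun u => d ∈ u),
          ENNReal.ofReal (γ u) ^ lam * TT b m (t + 1) (α * lam) u (V (yy c)) := by
      rw [← nsmul_eq_mul, ← Finset.sum_const]
      refine Finset.sum_le_sum fun c hc => ?_
      refine le_trans ?_ (TH_rpow_le hb α h0 h1 γ d (V (yy c)))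
      gcongr
      refine TH_le_of_EE_le hb hα γ d _ _ (fun j hj => by rw [hV2 _ j hj, hV2 _ j hj]) ?_
      exact hmin _ (yy_mem hn c (by simpa [II] using hc))
    have hfin : ((II b n).card : ℝ≥0∞) * ((b : ℝ≥0∞) ^ (n + 1) * (TH b m (t + 1) α γ d (V y0)) ^ lam) ≤
        ((II b n).card : ℝ≥0∞) * ∑ u ∈ Finset.univ.powerset.filter (fun u => d ∈ u),
          ENNReal.ofReal (γ u) ^ lam * (2 * MM b (α * lam) ^ u.card) := by
      calc _ = (b : ℝ≥0∞) ^ (n + 1) *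
            (((II b n).card : ℝ≥0∞) * (TH b m (t + 1) α γ d (V y0)) ^ lam) := by ring
        _ ≤ (b : ℝ≥0∞) ^ (n + 1) * ∑ c ∈ II b n,
            ∑ u ∈ Finset.univ.powerset.filter (fun u => d ∈ u),
              ENNReal.ofReal (γ u) ^ lam * TT b m (t + 1) (α * lam) u (V (yy c)) := by gcongr
        _ = ∑ u ∈ Finset.univ.powerset.filter (fun u => d ∈ u), ENNReal.ofReal (γ u) ^ lam *
              ((b : ℝ≥0∞) ^ (n + 1) * ∑ c ∈ II b n, TT b m (t + 1) (α * lam) u (V (yy c))) := by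
            rw [Finset.sum_comm, Finset.mul_sum]
            refine Finset.sum_congr rfl fun u _ => ?_
            rw [← Finset.mul_sum]; ring
        _ ≤ ∑ u ∈ Finset.univ.powerset.filter (fun u => d ∈ u), ENNReal.ofReal (γ u) ^ lam *
              ((II b n).card * (2 * MM b (α * lam) ^ u.card)) := by
            refine Finset.sum_le_sum fun u hu => ?_
            refine mul_le_mul_right ?_ _
            exact avg_bound hn hβ d u (Finset.mem_filter.1 hu).2 (fun c => V (yy c)) G
              (fun c => hV1 _) (fun c j hj => hV2 _ j hj)
        _ = _ := by
            rw [Finset.mul_sum]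
            exact Finset.sum_congr rfl fun u _ => by ring
    rw [ENNReal.mul_le_mul_iff_right hcard (ENNReal.natCast_ne_top _)] at hfin
    simp only [div_eq_mul_inv]
    rw [← Finset.sum_mul, ← div_eq_mul_inv, ENNReal.le_div_iff_mul_le (Or.inl hbp) (Or.inl hbt), mul_comm]
    exact hfin
  · have : m - w = 0 := by omega
    rw [this]
    refine (TH_rpow_le hb α h0 h1 γ d _).trans (Finset.sum_le_sum fun u _ => ?_)
    rw [pow_zero, div_one]
    gcongr
    exact (TT_le _ u _).trans (le_mul_of_one_le_left' (by norm_num))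

end SCS

theorem reduced_SCS_error_bound_poly (b m s : ℕ) (hb : Nat.Prime b) [Fact (Nat.Prime b)]
    (hm : 0 < m) (hs : 0 < s) (N : ℕ) (hN : N = b ^ m) (α : ℝ) (hα : 1 < α)
    (γ : Finset (Fin s) → ℝ) (hγ : ∀ u, 0 < γ u)
    (w : Fin s → ℕ) (hw : Monotone w)
    (g0 : Fin s → Polynomial (ZMod b)) (g : Fin s → Polynomial (ZMod b))
    -- the vector considered in step `d` of the algorithm, with candidate `y` in place `d`:
    (v : Fin s → Polynomial (ZMod b) → (Fin s → Polynomial (ZMod b)))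
    (hv : ∀ d y j, v d y j =
      if j < d then X ^ (w j) * g j
      else if j = d then X ^ (w d) * y else g0 j)
    -- each component is chosen from the reduced search space, minimizing the error:
    (halg : ∀ d : Fin s, g d ∈ polyReducedSearch b m (w d) ∧
      ∀ y ∈ polyReducedSearch b m (w d),
        walshErrSq b m s α γ (v d (g d)) ≤ walshErrSq b m s α γ (v d y))
    (lam : ℝ) (hlam1 : 1 / α < lam) (hlam2 : lam ≤ 1) :
    walshErrSq b m s α γ (fun j => X ^ (w j) * g j) ≤
      (∑ d : Fin s, ∑ u ∈ Finset.univ.powerset.filter (fun u => d ∈ u),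
          (γ u) ^ lam *
            (2 * ((b : ℝ) ^ (α * lam) * ((b : ℝ) - 1) / ((b : ℝ) ^ (α * lam) - b)) ^ u.card)
            / (b : ℝ) ^ (m - w d))
        ^ (1 / lam) := by
  obtain ⟨t, rfl⟩ : ∃ t, s = t + 1 := ⟨s - 1, by omega⟩
  have hb1 : 1 < b := hb.one_lt
  have hb0 : (0:ℝ) < b := by positivity
  have hα0 : 0 < α := by linarith
  have h0 : 0 < lam := lt_trans (by positivity) hlam1
  have hβ : 1 < α * lam := by
    rw [div_lt_iff₀ hα0] at hlam1
    linarith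
  have hW : ∀ g, walshErrSq b m (t + 1) α γ g = (SCS.EE b m (t + 1) α γ g).toReal :=
    fun g => SCS.walsh_eq hb1 hα γ hγ g
  set B : Fin (t + 1) → Finset (Fin (t + 1)) → ℝ := fun d u => (γ u) ^ lam *
    (2 * (SCS.mu b (α * lam)) ^ u.card) / (b : ℝ) ^ (m - w d) with hB
  have hmu := SCS.mu_pos hb1 hβ
  have hBpos : ∀ d u, 0 ≤ B d u := by
    intro d u
    have := hγ u
    simp only [hB]
    positivity
  have hstep : ∀ d, (SCS.TH b m (t + 1) α γ d (v d (g d))) ^ lam ≤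
      ∑ u ∈ Finset.univ.powerset.filter (fun u => d ∈ u), ENNReal.ofReal (B d u) := by
    intro d
    have h := SCS.step_bound (m := m) hα h0 hlam2 hβ γ d (w d) (v d)
      (fun j => if j < d then X ^ (w j) * g j else g0 j)
      (fun y => by rw [hv]; simp) (fun y j hj => by rw [hv]; simp [hj]) (g d)
      (fun y hy => by
        have := (halg d).2 y hy
        rw [hW, hW] at this
        exact (ENNReal.toReal_le_toReal (SCS.EE_ne_top hb1 hα γ _)
          (SCS.EE_ne_top hb1 hα γ _)).1 this)
    refine h.trans (le_of_eq (Finset.sum_congr rfl fun u _ => ?_))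
    rw [SCS.MM_eq hb1 hβ, hB]
    have hg := hγ u
    simp only
    rw [ENNReal.ofReal_div_of_pos (by positivity), ENNReal.ofReal_mul (by positivity),
      ENNReal.ofReal_mul (by positivity), ENNReal.ofReal_pow hmu.le, ENNReal.ofReal_pow hb0.le,
      ENNReal.ofReal_natCast, ENNReal.ofReal_rpow_of_pos hg, ENNReal.ofReal_ofNat]
  have hsplit : SCS.EE b m (t + 1) α γ (fun j => X ^ (w j) * g j) ≤
      ∑ d, SCS.TH b m (t + 1) α γ d (v d (g d)) := by
    classical
    have hne : ∀ u ∈ Finset.univ.powerset.filter (fun u : Finset (Fin (t + 1)) => u ≠ ∅),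
        u.Nonempty := fun u hu => Finset.nonempty_iff_ne_empty.2 (Finset.mem_filter.1 hu).2
    have hex : ∀ u : Finset (Fin (t + 1)), ∃ d, u.Nonempty → d ∈ u ∧ ∀ j ∈ u, j ≤ d := by
      intro u
      by_cases hu : u.Nonempty
      · exact ⟨u.max' hu, fun _ => ⟨u.max'_mem hu, fun j hj => u.le_max' j hj⟩⟩
      · exact ⟨0, fun h => absurd h hu⟩
    choose M hM using hex
    unfold SCS.EE
    rw [← Finset.sum_fiberwise _ M]
    refine Finset.sum_le_sum fun d _ => ?_
    unfold SCS.TH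
    refine le_trans (le_of_eq (Finset.sum_congr rfl fun u hu => ?_))
      (Finset.sum_le_sum_of_subset (f := fun u => ENNReal.ofReal (γ u) *
        SCS.TT b m (t + 1) α u (v d (g d))) ?_)
    · obtain ⟨hu1, rfl⟩ := Finset.mem_filter.1 hu
      congr 1
      refine SCS.TT_congr α u _ _ fun j hj => ?_
      have hle := (hM u (hne u hu1)).2 j hj
      rw [hv]
      rcases hle.lt_or_eq with h | h
      · rw [if_pos h]
      · rw [if_neg (by rw [h]; exact lt_irrefl _), if_pos h, h]
    · intro u hu
      obtain ⟨hu1, rfl⟩ := Finset.mem_filter.1 hu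
      exact Finset.mem_filter.2 ⟨(Finset.mem_filter.1 hu1).1, (hM u (hne u hu1)).1⟩
  have hfinal : SCS.EE b m (t + 1) α γ (fun j => X ^ (w j) * g j) ^ lam ≤
      ENNReal.ofReal (∑ d, ∑ u ∈ Finset.univ.powerset.filter (fun u => d ∈ u), B d u) := by
    rw [ENNReal.ofReal_sum_of_nonneg (fun d _ => Finset.sum_nonneg fun u _ => hBpos d u)]
    refine le_trans (ENNReal.rpow_le_rpow hsplit h0.le) ?_
    refine (SCS.rpow_sum_le _ _ h0 hlam2).trans (Finset.sum_le_sum fun d _ => ?_)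
    rw [ENNReal.ofReal_sum_of_nonneg (fun u _ => hBpos d u)]
    exact hstep d
  have hS : 0 ≤ ∑ d, ∑ u ∈ Finset.univ.powerset.filter (fun u => d ∈ u), B d u :=
    Finset.sum_nonneg fun d _ => Finset.sum_nonneg fun u _ => hBpos d u
  change _ ≤ (∑ d, ∑ u ∈ Finset.univ.powerset.filter (fun u => d ∈ u), B d u) ^ (1 / lam)
  rw [hW, one_div, Real.le_rpow_inv_iff_of_pos ENNReal.toReal_nonneg hS h0, ENNReal.toReal_rpow]
  exact ENNReal.toReal_le_of_le_ofReal hS hfinal
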